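/- arXiv:0710.0330 — 2 statements merged into one kernel-verified Lean document; each statement's English description precedes it below -/
import Mathlib

section
/- Let k be a field and let φ be a multiplicative ring seminorm on the polynomial ring k[X] (φ(0)=0, φ(1)=1, φ(fg)=φ(f)φ(g), φ(f+g) ≤ φ(f)+φ(g)) such that φ(c) = 1 for every nonzero constant c ∈ k and φ(X) < 1. Then for every nonzero polynomial f ∈ k[X] one has φ(f) = φ(X)^m, where m is the multiplicity of 0 as a root of f (i.e. the largest m with X^m dividing f), with the convention 0^0 = 1. -/
/-- Constants have seminorm at most one, so a geometric series bounds `φ` uniformly. -/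
lemma MulRingSeminorm.polynomial_le_inv_one_sub {k : Type*} [Field k]
    (φ : MulRingSeminorm (Polynomial k))
    (hconst : ∀ c : k, c ≠ 0 → φ (Polynomial.C c) = 1)
    (hX : φ Polynomial.X < 1) (p : Polynomial k) :
    φ p ≤ (1 - φ Polynomial.X)⁻¹ := by
  have hC (c : k) : φ (Polynomial.C c) ≤ 1 := by
    rcases eq_or_ne c 0 with rfl | hc
    · simp
    · exact (hconst c hc).le
  have hpos : 0 < 1 - φ Polynomial.X := sub_pos.2 hX
  have hX0 : 0 ≤ φ Polynomial.X := apply_nonneg φ _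
  induction hn : p.natDegree generalizing p with
  | zero =>
    rw [Polynomial.eq_C_of_natDegree_eq_zero hn]
    exact (hC _).trans ((one_le_inv₀ hpos).2 (by linarith))
  | succ n ih =>
    have hdiv : φ p.divX ≤ (1 - φ Polynomial.X)⁻¹ :=
      ih _ (by rw [Polynomial.natDegree_divX_eq_natDegree_tsub_one, hn]; rfl)
    calc φ p = φ (p.divX * Polynomial.X + Polynomial.C (p.coeff 0)) := by
          rw [Polynomial.divX_mul_X_add]
      _ ≤ φ p.divX * φ Polynomial.X + 1 :=
          (map_add_le_add φ _ _).trans (by rw [map_mul]; gcongr; exact hC _)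
      _ ≤ (1 - φ Polynomial.X)⁻¹ * φ Polynomial.X + 1 := by gcongr
      _ = (1 - φ Polynomial.X)⁻¹ := by field_simp; ring

lemma MulRingSeminorm.polynomial_le_one {k : Type*} [Field k]
    (φ : MulRingSeminorm (Polynomial k))
    (hconst : ∀ c : k, c ≠ 0 → φ (Polynomial.C c) = 1)
    (hX : φ Polynomial.X < 1) (p : Polynomial k) : φ p ≤ 1 := by
  by_contra! h
  obtain ⟨n, hn⟩ := pow_unbounded_of_one_lt (1 - φ Polynomial.X)⁻¹ h
  rw [← map_pow] at hn
  exact hn.not_ge (φ.polynomial_le_inv_one_sub hconst hX _)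

/-- If `p = c - u` with `c` a nonzero constant and `X ∣ u`, then `p` divides `c ^ n - u ^ n`,
whose seminorm is at least `1 - φ X ^ n`. -/
lemma MulRingSeminorm.polynomial_eq_one_of_coeff_zero_ne_zero {k : Type*} [Field k]
    (φ : MulRingSeminorm (Polynomial k))
    (hconst : ∀ c : k, c ≠ 0 → φ (Polynomial.C c) = 1)
    (hX : φ Polynomial.X < 1) {p : Polynomial k} (hp : p.coeff 0 ≠ 0) : φ p = 1 := by
  have hle := φ.polynomial_le_one hconst hX
  refine (hle p).antisymm ?_
  set c := Polynomial.C (p.coeff 0) with hc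
  set u := -(p.divX * Polynomial.X) with hu
  have hpcu : c - u = p := by
    rw [hu, sub_neg_eq_add, add_comm, Polynomial.divX_mul_X_add]
  have hφu : φ u ≤ φ Polynomial.X := by
    rw [hu, map_neg_eq_map, map_mul]
    exact mul_le_of_le_one_left (apply_nonneg φ _) (hle _)
  have hlower (n : ℕ) : 1 - φ Polynomial.X ^ n ≤ φ p := by
    obtain ⟨q, hq⟩ := sub_dvd_pow_sub_pow c u n
    have h₁ : φ (c ^ n - u ^ n) ≤ φ p := by
      rw [hq, map_mul, hpcu]
      exact mul_le_of_le_one_right (apply_nonneg φ _) (hle q)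
    have h₂ : φ (c ^ n) ≤ φ (c ^ n - u ^ n) + φ (u ^ n) := by
      simpa using map_add_le_add φ (c ^ n - u ^ n) (u ^ n)
    rw [map_pow, map_pow, hc, hconst _ hp, one_pow] at h₂
    have h₃ : φ u ^ n ≤ φ Polynomial.X ^ n := pow_le_pow_left₀ (apply_nonneg φ _) hφu n
    linarith
  have hlim := (tendsto_pow_atTop_nhds_zero_of_lt_one (apply_nonneg φ _) hX).const_sub 1
  rw [sub_zero] at hlim
  exact le_of_tendsto' hlim hlower

/-- A multiplicative ring seminorm on `k[X]` that is trivial on nonzero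
constants and has `φ X < 1` is determined on nonzero polynomials by the multiplicity
of `0` as a root: `φ f = φ X ^ m` where `m = rootMultiplicity 0 f`. -/
theorem stmt0 {k : Type*} [Field k] (φ : MulRingSeminorm (Polynomial k))
    (hconst : ∀ c : k, c ≠ 0 → φ (Polynomial.C c) = 1)
    (hX : φ Polynomial.X < 1) :
    ∀ f : Polynomial k, f ≠ 0 →
      φ f = φ Polynomial.X ^ Polynomial.rootMultiplicity 0 f := by
  intro f hf
  obtain ⟨g, hfg, hg⟩ := f.exists_eq_pow_rootMultiplicity_mul_and_not_dvd hf 0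
  rw [map_zero, sub_zero] at hfg hg
  have hg1 := φ.polynomial_eq_one_of_coeff_zero_ne_zero hconst hX
    (mt Polynomial.X_dvd_iff.2 hg)
  conv_lhs => rw [hfg, map_mul, map_pow, hg1, mul_one]
end

section
/- Let A be a commutative ring, t ∈ A, and fix r ∈ (0,1). Let M be the set of multiplicative ring seminorms φ on A with φ(a) ≤ 1 for all a ∈ A, equipped with the topology induced by pointwise convergence of functions A → ℝ. Then there is a homeomorphism Ψ from the subspace { φ ∈ M : 0 < φ(t) < 1 } onto the product { φ ∈ M : φ(t) = r } × (0,1) such that for every φ in the source, the second component of Ψ(φ) is φ(t) and the first component is the multiplicative seminorm a ↦ φ(a)^{c(φ)}, where c(φ) = log r / log φ(t) (so that in particular a ↦ φ(a)^{c(φ)} is again a multiplicative ring seminorm bounded by 1, taking the value r at t). -/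
/-- The Berkovich spectrum of `A` with the trivial Banach norm: multiplicative ring
seminorms on `A` bounded by `1`. -/
abbrev BerkSpec (A : Type*) [CommRing A] :=
  {φ : MulRingSeminorm A // ∀ a, φ a ≤ 1}

/-- The topology of pointwise convergence on the Berkovich spectrum. -/
instance (A : Type*) [CommRing A] : TopologicalSpace (BerkSpec A) :=
  TopologicalSpace.induced (fun φ : BerkSpec A => (⇑φ.1 : A → ℝ)) inferInstance

/-- A multiplicative ring seminorm bounded by `1` on the natural numbers is nonarchimedean. -/
theorem MulRingSeminorm.isNonarchimedean_of_natCast_le_one {A : Type*} [CommRing A]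
    (φ : MulRingSeminorm A) (h : ∀ n : ℕ, φ n ≤ 1) : IsNonarchimedean φ := by
  intro x y
  have hM0 : 0 ≤ max (φ x) (φ y) := (apply_nonneg φ x).trans (le_max_left _ _)
  have hpow (m : ℕ) : φ (x + y) ^ m ≤ (m + 1) * max (φ x) (φ y) ^ m := by
    rw [← map_pow, add_pow]
    calc φ (∑ k ∈ Finset.range (m + 1), x ^ k * y ^ (m - k) * (m.choose k : A))
        ≤ ∑ k ∈ Finset.range (m + 1), φ (x ^ k * y ^ (m - k) * (m.choose k : A)) :=
          Finset.le_sum_of_subadditive φ (map_zero φ).le (map_add_le_add φ) _ _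
      _ ≤ ∑ _k ∈ Finset.range (m + 1), max (φ x) (φ y) ^ m := by
          refine Finset.sum_le_sum fun k hk ↦ ?_
          have hkm : k + (m - k) = m := by grind
          calc φ (x ^ k * y ^ (m - k) * (m.choose k : A))
              = φ x ^ k * φ y ^ (m - k) * φ (m.choose k : A) := by simp only [map_mul, map_pow]
            _ ≤ φ x ^ k * φ y ^ (m - k) * 1 := by
                gcongr
                exact h _
            _ ≤ max (φ x) (φ y) ^ k * max (φ x) (φ y) ^ (m - k) * 1 := by
                gcongr
                · exact le_max_left _ _
                · exact le_max_right _ _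
            _ = max (φ x) (φ y) ^ m := by rw [mul_one, ← pow_add, hkm]
      _ = (m + 1) * max (φ x) (φ y) ^ m := by simp
  rcases hM0.eq_or_lt with hM | hM
  · simpa [← hM] using hpow 1
  refine le_of_forall_gt_imp_ge_of_dense fun a ha ↦ ?_
  obtain ⟨m, hm⟩ := Real.exists_natCast_add_one_lt_pow_of_one_lt ((one_lt_div hM).mpr ha)
  rw [div_pow, lt_div_iff₀ (by positivity)] at hm
  have hlt := (hpow m).trans_lt hm
  exact (lt_of_pow_lt_pow_left₀ m (hM.trans ha).le hlt).le

/-- A positive real power of a nonarchimedean multiplicative ring seminorm. -/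
noncomputable def MulRingSeminorm.rpow {A : Type*} [CommRing A] (φ : MulRingSeminorm A)
    (hφ : IsNonarchimedean φ) (c : ℝ) (hc : 0 < c) : MulRingSeminorm A where
  toFun a := φ a ^ c
  map_zero' := by simp [Real.zero_rpow hc.ne']
  map_one' := by simp
  neg' a := by simp
  map_mul' a b := by
    rw [map_mul, Real.mul_rpow (apply_nonneg φ a) (apply_nonneg φ b)]
  add_le' a b := by
    have ha := Real.rpow_nonneg (apply_nonneg φ a) c
    have hb := Real.rpow_nonneg (apply_nonneg φ b) c
    rcases le_max_iff.mp (hφ a b) with h | h <;>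
      linarith [Real.rpow_le_rpow (apply_nonneg φ _) h hc.le]

namespace BerkSpec

variable {A : Type*} [CommRing A]

/-- Continuity into the Berkovich spectrum is continuity of all evaluations. -/
theorem continuous_iff {X : Type*} [TopologicalSpace X] {f : X → BerkSpec A} :
    Continuous f ↔ ∀ a, Continuous fun x ↦ (f x).1 a :=
  continuous_induced_rng.trans continuous_pi_iff

theorem continuous_eval (a : A) : Continuous fun φ : BerkSpec A ↦ φ.1 a :=
  continuous_iff.mp continuous_id a

/-- A positive real power of a point of the Berkovich spectrum. -/
noncomputable def rpow (φ : BerkSpec A) (c : ℝ) (hc : 0 < c) : BerkSpec A :=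
  ⟨φ.1.rpow (φ.1.isNonarchimedean_of_natCast_le_one fun n ↦ φ.2 n) c hc,
    fun a ↦ Real.rpow_le_one (apply_nonneg φ.1 a) (φ.2 a) hc.le⟩

@[simp]
theorem rpow_apply (φ : BerkSpec A) (c : ℝ) (hc : 0 < c) (a : A) :
    (φ.rpow c hc).1 a = φ.1 a ^ c :=
  rfl

theorem continuous_rpow {X : Type*} [TopologicalSpace X] {f : X → BerkSpec A} {c : X → ℝ}
    (hf : Continuous f) (hc : Continuous c) (hpos : ∀ x, 0 < c x) :
    Continuous fun x ↦ (f x).rpow (c x) (hpos x) :=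
  continuous_iff.mpr fun a ↦ ((continuous_eval a).comp hf).rpow hc fun x ↦ Or.inr (hpos x)

theorem rpow_logb_rpow_logb (φ : BerkSpec A) {x y : ℝ}
    (hxy : 0 < Real.logb x y) (hyx : 0 < Real.logb y x) :
    (φ.rpow (Real.logb x y) hxy).rpow (Real.logb y x) hyx = φ := by
  refine Subtype.ext (MulRingSeminorm.ext fun a ↦ ?_)
  rw [rpow_apply, rpow_apply, ← Real.rpow_mul (apply_nonneg φ.1 a), ← Real.inv_logb x y,
    mul_inv_cancel₀ hxy.ne', Real.rpow_one]

/-- The locus `{0 < φ(t) < 1}` is the product of the fibre `{φ(t) = r}` with `(0,1)`. -/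
noncomputable def fiberHomeomorph (t : A) {r : ℝ} (hr0 : 0 < r) (hr1 : r < 1) :
    {φ : BerkSpec A // 0 < φ.1 t ∧ φ.1 t < 1} ≃ₜ
      ({φ : BerkSpec A // φ.1 t = r} × Set.Ioo (0 : ℝ) 1) where
  toFun φ :=
    (⟨φ.1.rpow (Real.logb (φ.1.1 t) r)
        (Real.logb_pos_of_base_lt_one φ.2.1 φ.2.2 hr0 hr1),
      Real.rpow_logb φ.2.1 φ.2.2.ne hr0⟩, ⟨φ.1.1 t, φ.2⟩)
  invFun p :=
    ⟨p.1.1.rpow (Real.logb r p.2) (Real.logb_pos_of_base_lt_one hr0 hr1 p.2.2.1 p.2.2.2), by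
      rw [rpow_apply, p.1.2, Real.rpow_logb hr0 hr1.ne p.2.2.1]
      exact p.2.2⟩
  left_inv φ := Subtype.ext (rpow_logb_rpow_logb φ.1 _ _)
  right_inv := by
    rintro ⟨⟨φ, hφ⟩, ⟨ρ, hρ0, hρ1⟩⟩
    have ht : φ.1 t ^ Real.logb r ρ = ρ := by rw [hφ, Real.rpow_logb hr0 hr1.ne hρ0]
    refine Prod.ext (Subtype.ext ?_) (Subtype.ext ht)
    simp only [rpow_apply, ht]
    exact rpow_logb_rpow_logb φ _ _
  continuous_toFun := by
    have ht : Continuous fun φ : {φ : BerkSpec A // 0 < φ.1 t ∧ φ.1 t < 1} ↦ φ.1.1 t :=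
      (continuous_eval t).comp continuous_subtype_val
    refine .prodMk (.subtype_mk (continuous_rpow continuous_subtype_val ?_ _) _)
      (ht.subtype_mk _)
    exact continuous_const.div (ht.log fun φ ↦ φ.2.1.ne')
      fun φ ↦ (Real.log_neg φ.2.1 φ.2.2).ne
  continuous_invFun := by
    refine .subtype_mk
      (continuous_rpow (continuous_subtype_val.comp continuous_fst) ?_ _) _
    exact ((continuous_subtype_val.comp continuous_snd).log fun p ↦ p.2.2.1.ne').div_const _

end BerkSpec

/-- for fixed `r ∈ (0,1)`, the locus `{0 < φ(t) < 1}` of the Berkovich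
spectrum is homeomorphic to `{φ(t) = r} × (0,1)`, compatibly with `φ ↦ φ(t)`, via
`φ ↦ (a ↦ φ(a)^{log r / log φ(t)}, φ(t))`. -/
theorem stmt16 {A : Type*} [CommRing A] (t : A) (r : ℝ) (hr0 : 0 < r) (hr1 : r < 1) :
    ∃ Ψ : {φ : BerkSpec A // 0 < φ.1 t ∧ φ.1 t < 1} ≃ₜ
          ({φ : BerkSpec A // φ.1 t = r} × Set.Ioo (0 : ℝ) 1),
      ∀ φ : {φ : BerkSpec A // 0 < φ.1 t ∧ φ.1 t < 1},
        ((Ψ φ).2 : ℝ) = φ.1.1 t ∧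
        ∀ a : A, (Ψ φ).1.1.1 a = (φ.1.1 a) ^ (Real.log r / Real.log (φ.1.1 t)) := by
  exact ⟨BerkSpec.fiberHomeomorph t hr0 hr1, fun φ ↦ ⟨rfl, fun a ↦ rfl⟩⟩
end
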